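/- arXiv:1710.09959 — 2 statements merged into one kernel-verified Lean document; each statement's English description precedes it below -/
import Mathlib

section
/- Let θ ∈ (0, π/10]. If q is an action minimizer of A over P(Q_S, Q_{E₂}) and q has a boundary collision (i.e. qᵢ(t₀) = qⱼ(t₀) for some i ≠ j and some t₀ ∈ {0,1}), then its action satisfies A(q) ≥ (3/8)·16^{1/3}·[ π^{2/3} + θ^{2/3} + 2·(2θ)^{2/3} ]. -/
open Real MeasureTheory Set
open scoped ENNReal

noncomputable section

/-- Euclidean norm on `ℝ × ℝ` (row vectors in the plane). -/
def enorm2 (v : ℝ × ℝ) : ℝ := Real.sqrt (v.1 ^ 2 + v.2 ^ 2)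

/-- Row vector multiplied on the right by the rotation matrix `R θ`
with rows `(cos θ, sin θ)` and `(-sin θ, cos θ)`. -/
def rotV (θ : ℝ) (v : ℝ × ℝ) : ℝ × ℝ :=
  (v.1 * Real.cos θ - v.2 * Real.sin θ, v.1 * Real.sin θ + v.2 * Real.cos θ)

/-- `H¹([0,1],(ℝ²)⁴)`: absolutely continuous paths `[0,1] → (ℝ²)⁴` with
square-integrable derivative, recorded via an integrable (a.e.-)derivative `v`
together with the integral representation of `q`. -/
structure H1Path4 where
  q : ℝ → Fin 4 → ℝ × ℝ
  v : ℝ → Fin 4 → ℝ × ℝ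
  hvInt : ∀ i : Fin 4, IntegrableOn (fun t => v t i) (Icc (0:ℝ) 1)
  hrep : ∀ i : Fin 4, ∀ t ∈ Icc (0:ℝ) 1, q t i = q 0 i + ∫ s in (0:ℝ)..t, v s i
  hL2 : ∀ i : Fin 4, IntegrableOn (fun t => enorm2 (v t i) ^ 2) (Icc (0:ℝ) 1)

/-- Center of mass at the origin throughout `[0,1]` (the path lies in `χ`). -/
def H1Path4.inChi (p : H1Path4) : Prop := ∀ t ∈ Icc (0:ℝ) 1, ∑ i, p.q t i = 0

/-- The Lagrangian action functional `A`, with value `+∞` allowed. -/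
def action (p : H1Path4) : ℝ≥0∞ :=
  ∫⁻ t in Icc (0:ℝ) 1,
    (ENNReal.ofReal ((1/2) * ∑ i, enorm2 (p.v t i) ^ 2)
      + ∑ i : Fin 4, ∑ j ∈ Finset.univ.filter (fun j => i < j),
          (ENNReal.ofReal (enorm2 (p.q t i - p.q t j)))⁻¹)

/-- The starting boundary configuration set `Q_S` (double isosceles with order
constraints). -/
def QSset : Set (Fin 4 → ℝ × ℝ) :=
  { c | ∃ a₁ b₁ c₁ : ℝ, 0 ≤ b₁ ∧ 0 ≤ c₁ ∧
      c = ![(-a₁ - c₁, 0), (-a₁, 0), ((2*a₁ + c₁)/2, b₁), ((2*a₁ + c₁)/2, -b₁)] }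

/-- The ending boundary configuration set `Q_{E₁}`. -/
def QE1set (θ : ℝ) : Set (Fin 4 → ℝ × ℝ) :=
  { c | ∃ a₂ b₂ c₂ : ℝ, 0 ≤ b₂ ∧ 0 ≤ c₂ ∧
      c = fun i => rotV θ (![(-b₂, -a₂), (-c₂, a₂), (c₂, a₂), (b₂, -a₂)] i) }

/-- The ending boundary configuration set `Q_{E₂}`. -/
def QE2set (θ : ℝ) : Set (Fin 4 → ℝ × ℝ) :=
  { c | ∃ a₂ b₂ c₂ : ℝ, 0 ≤ b₂ ∧ 0 ≤ c₂ ∧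
      c = fun i => rotV θ (![(-a₂, -b₂), (-a₂, b₂), (a₂, c₂), (a₂, -c₂)] i) }

/-- Membership in the admissible class `P(Q_S, E)`. -/
def inAdm (E : Set (Fin 4 → ℝ × ℝ)) (p : H1Path4) : Prop :=
  p.inChi ∧ p.q 0 ∈ QSset ∧ p.q 1 ∈ E

/-- `p` is an action minimizer over `P(Q_S, E)`. -/
def isMin (E : Set (Fin 4 → ℝ × ℝ)) (p : H1Path4) : Prop :=
  inAdm E p ∧ ∀ p' : H1Path4, inAdm E p' → action p ≤ action p'

/-- The Newtonian equations of the equal-mass four-body problem, on a set `s`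
of times. -/
def newton (Q : ℝ → Fin 4 → ℝ × ℝ) (s : Set ℝ) : Prop :=
  ∀ i : Fin 4, ∀ t ∈ s,
    deriv (deriv (fun u => Q u i)) t =
      ∑ j ∈ Finset.univ.erase i, (1 / enorm2 (Q t j - Q t i) ^ 3) • (Q t j - Q t i)


theorem AbsolutelyContinuousOnInterval.of_dist_le {f₁ f₂ g : ℝ → ℝ} {a b C : ℝ}
    (h₁ : AbsolutelyContinuousOnInterval f₁ a b) (h₂ : AbsolutelyContinuousOnInterval f₂ a b)
    (h : ∀ s ∈ uIcc a b, ∀ t ∈ uIcc a b,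
      dist (g s) (g t) ≤ C * (dist (f₁ s) (f₁ t) + dist (f₂ s) (f₂ t))) :
    AbsolutelyContinuousOnInterval g a b := by
  unfold AbsolutelyContinuousOnInterval at h₁ h₂ ⊢
  refine squeeze_zero' (.of_forall fun E => Finset.sum_nonneg fun i _ => dist_nonneg) ?_
    (by simpa using (h₁.add h₂).const_mul C)
  filter_upwards [Filter.mem_inf_of_right (Filter.mem_principal_self _)] with E hE
  rw [← Finset.sum_add_distrib, Finset.mul_sum]
  refine Finset.sum_le_sum fun i hi => ?_
  exact h _ (hE.1 i hi).1 _ (hE.1 i hi).2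

theorem abs_sqrt_sq_add_sq_sub_le (a b c d : ℝ) :
    |√(a ^ 2 + b ^ 2) - √(c ^ 2 + d ^ 2)| ≤ |a - c| + |b - d| := by
  have key : ∀ a b c d : ℝ, √(a ^ 2 + b ^ 2) ≤ √(c ^ 2 + d ^ 2) + (|a - c| + |b - d|) := by
    intro a b c d
    have := norm_add_le (⟨c, d⟩ : ℂ) (⟨a - c, b - d⟩ : ℂ)
    have h2 := Complex.norm_le_abs_re_add_abs_im (⟨a - c, b - d⟩ : ℂ)
    have e : (⟨c, d⟩ : ℂ) + ⟨a - c, b - d⟩ = ⟨a, b⟩ := by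
      apply Complex.ext <;> simp
    rw [e] at this
    simp only [Complex.norm_eq_sqrt_sq_add_sq] at this h2
    linarith
  rw [abs_le]
  have h1 := key a b c d
  have h2 := key c d a b
  rw [abs_sub_comm c a, abs_sub_comm d b] at h2
  constructor <;> linarith

/-- Algebraic form of the Hamilton–Jacobi inequality for the calibration
`k (ρ cos σ - ⟨e, r⟩) / sin σ`, where `σ' = 2 k / ρ`. -/
theorem calibration_deriv_le {X Y u v ex ey ρ c s k : ℝ} (hρ : ρ ≠ 0) (hs : s ≠ 0)
    (hcs : s ^ 2 + c ^ 2 = 1) (he : ex ^ 2 + ey ^ 2 = 1) (hXY : X ^ 2 + Y ^ 2 = ρ ^ 2) :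
    k * ((((X * u + Y * v) / ρ * c + ρ * (-s * (2 * k * ρ⁻¹))) - (ex * u + ey * v)) * s -
      (ρ * c - (ex * X + ey * Y)) * (c * (2 * k * ρ⁻¹))) / s ^ 2 ≤ (u ^ 2 + v ^ 2) / 4 - k ^ 2 := by
  have key : (u ^ 2 + v ^ 2) / 4 - k ^ 2 -
      k * ((((X * u + Y * v) / ρ * c + ρ * (-s * (2 * k * ρ⁻¹))) - (ex * u + ey * v)) * s -
      (ρ * c - (ex * X + ey * Y)) * (c * (2 * k * ρ⁻¹))) / s ^ 2 =
      (u / 2 - k * ((c * X / ρ - ex) / s)) ^ 2 + (v / 2 - k * ((c * Y / ρ - ey) / s)) ^ 2 := by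
    field_simp
    have h1 : Y ^ 2 = ρ ^ 2 - X ^ 2 := by linarith
    have h2 : ey ^ 2 = 1 - ex ^ 2 := by linarith
    have h3 : s ^ 2 = 1 - c ^ 2 := by linarith
    ring_nf
    simp only [h1, h2, h3]
    ring_nf
  nlinarith [sq_nonneg (u / 2 - k * ((c * X / ρ - ex) / s)),
    sq_nonneg (v / 2 - k * ((c * Y / ρ - ey) / s))]

theorem sq_sub_le_of_boundary_angles {u v : ℝ → ℝ} (x₀ y₀ : ℝ)
    (hu : IntervalIntegrable u volume 0 1) (hv : IntervalIntegrable v volume 0 1)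
    (hsq : IntervalIntegrable (fun t => u t ^ 2 + v t ^ 2) volume 0 1)
    {X Y ρ : ℝ → ℝ} (hX : X = fun t => x₀ + ∫ s in (0:ℝ)..t, u s)
    (hY : Y = fun t => y₀ + ∫ s in (0:ℝ)..t, v s)
    (hρ : ρ = fun t => √(X t ^ 2 + Y t ^ 2))
    (hinv : IntervalIntegrable (fun t => (ρ t)⁻¹) volume 0 1)
    (hne : ∀ᵐ t, t ∈ uIcc (0:ℝ) 1 → ρ t ≠ 0)
    {ε τ ex ey : ℝ} (hε : 0 < ε) (hετ : ε < τ) (hτ : τ < π) (he : ex ^ 2 + ey ^ 2 = 1)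
    (h0 : ρ 0 * cos ε ≤ ex * X 0 + ey * Y 0) (h1 : ex * X 1 + ey * Y 1 ≤ ρ 1 * cos τ) :
    (τ - ε) ^ 2 ≤ (∫ t in (0:ℝ)..1, (ρ t)⁻¹) ^ 2 * ∫ t in (0:ℝ)..1, (u t ^ 2 + v t ^ 2) := by
  set S := ∫ t in (0:ℝ)..1, (ρ t)⁻¹ with hS
  have hρ0 : ∀ t, 0 ≤ ρ t := fun t => by rw [hρ]; positivity
  have hSpos : 0 < S := by
    rw [hS, intervalIntegral.integral_pos_iff_support_of_nonneg_ae
      (.of_forall fun t => inv_nonneg.2 (hρ0 t)) hinv]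
    refine ⟨zero_lt_one, ?_⟩
    have : volume (Ioc (0:ℝ) 1) ≤
        volume (Function.support (fun t => (ρ t)⁻¹) ∩ Ioc (0:ℝ) 1) := by
      refine measure_mono_ae ?_
      filter_upwards [hne] with t ht hmem
      have hmem' : t ∈ Ioc (0:ℝ) 1 := hmem
      refine ⟨?_, hmem'⟩
      rw [Function.mem_support]
      exact inv_ne_zero (ht (by rw [uIcc_of_le zero_le_one]; exact Ioc_subset_Icc_self hmem'))
    refine lt_of_lt_of_le ?_ this
    simp
  set k := (τ - ε) / (2 * S) with hk
  have hkpos : 0 < k := by rw [hk]; apply div_pos <;> linarith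
  set σ : ℝ → ℝ := fun t => ε + 2 * k * ∫ s in (0:ℝ)..t, (ρ s)⁻¹ with hσ
  have hσ0 : σ 0 = ε := by simp [hσ]
  have hσ1 : σ 1 = τ := by simp only [hσ, ← hS, hk]; field_simp; ring
  have hσmem : ∀ t ∈ uIcc (0:ℝ) 1, σ t ∈ Icc ε τ := by
    intro t ht
    rw [uIcc_of_le zero_le_one] at ht
    have a1 : 0 ≤ ∫ s in (0:ℝ)..t, (ρ s)⁻¹ :=
      intervalIntegral.integral_nonneg ht.1 fun s _ => inv_nonneg.2 (hρ0 s)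
    have a2 : ∫ s in (0:ℝ)..t, (ρ s)⁻¹ ≤ S :=
      intervalIntegral.integral_mono_interval le_rfl ht.1 ht.2
        (.of_forall fun s => inv_nonneg.2 (hρ0 s)) hinv
    have e1 : ε + 2 * k * S = τ := by rw [hk]; field_simp; ring
    constructor
    · simp only [hσ]; nlinarith
    · simp only [hσ]; rw [← e1]; gcongr
  have hsin : ∀ t ∈ uIcc (0:ℝ) 1, 0 < sin (σ t) := fun t ht =>
    sin_pos_of_pos_of_lt_pi (by linarith [(hσmem t ht).1]) (by linarith [(hσmem t ht).2])
  have hconst : ∀ c : ℝ, AbsolutelyContinuousOnInterval (fun _ : ℝ => c) 0 1 := fun c =>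
    contDiffOn_const.absolutelyContinuousOnInterval
  have h0mem : (0:ℝ) ∈ uIcc (0:ℝ) 1 := left_mem_uIcc
  have acX : AbsolutelyContinuousOnInterval X 0 1 := by
    rw [hX]; exact (hconst x₀).fun_add (hu.absolutelyContinuousOnInterval_intervalIntegral h0mem)
  have acY : AbsolutelyContinuousOnInterval Y 0 1 := by
    rw [hY]; exact (hconst y₀).fun_add (hv.absolutelyContinuousOnInterval_intervalIntegral h0mem)
  have acσ : AbsolutelyContinuousOnInterval σ 0 1 :=
    (hconst ε).fun_add
      ((hinv.absolutelyContinuousOnInterval_intervalIntegral h0mem).const_mul (2 * k))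
  have acρ : AbsolutelyContinuousOnInterval ρ 0 1 := by
    refine acX.of_dist_le (C := 1) acY fun s _ t _ => ?_
    simp only [hρ, Real.dist_eq, one_mul]
    exact abs_sqrt_sq_add_sq_sub_le _ _ _ _
  have accomp : ∀ f : ℝ → ℝ, ContDiffOn ℝ 1 f (Icc ε τ) →
      AbsolutelyContinuousOnInterval (fun t => f (σ t)) 0 1 := by
    intro f hf
    obtain ⟨K, hK⟩ := hf.exists_lipschitzOnWith one_ne_zero (convex_Icc _ _) isCompact_Icc
    refine acσ.of_dist_le (C := K) acσ fun s hs t ht => ?_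
    have := hK.dist_le_mul _ (hσmem s hs) _ (hσmem t ht)
    have h2 : 0 ≤ (K:ℝ) * dist (σ s) (σ t) := by positivity
    linarith
  have accos := accomp cos Real.contDiff_cos.contDiffOn
  have acsin := accomp (fun x => (sin x)⁻¹) (by
    refine Real.contDiff_sin.contDiffOn.inv fun x hx => ?_
    exact (sin_pos_of_pos_of_lt_pi (by linarith [hx.1]) (by linarith [hx.2])).ne')
  set F : ℝ → ℝ := fun t => k * ((ρ t * cos (σ t) - (ex * X t + ey * Y t)) * (sin (σ t))⁻¹) with hF
  have acF : AbsolutelyContinuousOnInterval F 0 1 :=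
    (((acρ.fun_mul accos).fun_sub ((acX.const_mul ex).fun_add (acY.const_mul ey))).fun_mul
      acsin).const_mul k
  have hderiv : ∀ᵐ t, t ∈ uIcc (0:ℝ) 1 → deriv F t ≤ (u t ^ 2 + v t ^ 2) / 4 - k ^ 2 := by
    filter_upwards [hne, hu.ae_hasDerivAt_integral, hv.ae_hasDerivAt_integral,
      hinv.ae_hasDerivAt_integral] with t hne hdu hdv hdσ ht
    have hs := (hsin t ht).ne'
    have dX : HasDerivAt X (u t) t := by rw [hX]; exact (hdu ht 0 h0mem).const_add x₀
    have dY : HasDerivAt Y (v t) t := by rw [hY]; exact (hdv ht 0 h0mem).const_add y₀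
    have dσ : HasDerivAt σ (2 * k * (ρ t)⁻¹) t := ((hdσ ht 0 h0mem).const_mul (2 * k)).const_add ε
    have hXY : X t ^ 2 + Y t ^ 2 = ρ t ^ 2 := by
      simp only [hρ]; rw [Real.sq_sqrt (by positivity)]
    have dρ : HasDerivAt ρ ((X t * u t + Y t * v t) / ρ t) t := by
      have := ((dX.fun_pow 2).fun_add (dY.fun_pow 2)).sqrt (by
        rw [hXY]; exact pow_ne_zero 2 (hne ht))
      have e : √(X t ^ 2 + Y t ^ 2) = ρ t := by rw [hρ]
      rw [e] at this
      rw [hρ]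
      convert! this using 1
      rw [← hρ]
      have := hne ht
      field_simp
      push_cast
      ring
    have dF := (((dρ.fun_mul dσ.cos).fun_sub ((dX.const_mul ex).fun_add (dY.const_mul ey))).fun_div
      dσ.sin hs).const_mul k
    have hFe : F = fun t => k * ((ρ t * cos (σ t) - (ex * X t + ey * Y t)) / sin (σ t)) := by
      funext t; simp only [hF, div_eq_mul_inv]
    rw [hFe, dF.deriv, ← mul_div_assoc]
    exact calibration_deriv_le (hne ht) hs (sin_sq_add_cos_sq _) he hXY
  have hint : F 1 - F 0 ≤ (∫ t in (0:ℝ)..1, (u t ^ 2 + v t ^ 2)) / 4 - k ^ 2 := by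
    rw [← acF.integral_deriv_eq_sub]
    calc _ ≤ ∫ t in (0:ℝ)..1, ((u t ^ 2 + v t ^ 2) / 4 - k ^ 2) := by
          refine intervalIntegral.integral_mono_ae_restrict zero_le_one
            acF.intervalIntegrable_deriv ((hsq.div_const 4).sub intervalIntegrable_const) ?_
          rw [Filter.EventuallyLE, ae_restrict_iff' measurableSet_Icc]
          rwa [uIcc_of_le zero_le_one] at hderiv
      _ = _ := by
          rw [intervalIntegral.integral_sub (hsq.div_const 4) intervalIntegrable_const]
          simp
  have hF0 : F 0 ≤ 0 := by
    have : 0 < (sin (σ 0))⁻¹ := inv_pos.2 (hsin 0 h0mem)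
    have h : ρ 0 * cos (σ 0) - (ex * X 0 + ey * Y 0) ≤ 0 := by rw [hσ0]; linarith
    exact mul_nonpos_of_nonneg_of_nonpos hkpos.le (mul_nonpos_of_nonpos_of_nonneg h this.le)
  have hF1 : 0 ≤ F 1 := by
    have : 0 < (sin (σ 1))⁻¹ := inv_pos.2 (hsin 1 right_mem_uIcc)
    have h : 0 ≤ ρ 1 * cos (σ 1) - (ex * X 1 + ey * Y 1) := by rw [hσ1]; linarith
    positivity
  have hfin : k ^ 2 * (4 * S ^ 2) ≤ (∫ t in (0:ℝ)..1, (u t ^ 2 + v t ^ 2)) / 4 * (4 * S ^ 2) := by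
    gcongr
    linarith
  have : k ^ 2 * (4 * S ^ 2) = (τ - ε) ^ 2 := by rw [hk]; field_simp; ring
  linarith

theorem sq_le_of_boundary_angle {u v : ℝ → ℝ} (x₀ y₀ : ℝ)
    (hu : IntervalIntegrable u volume 0 1) (hv : IntervalIntegrable v volume 0 1)
    (hsq : IntervalIntegrable (fun t => u t ^ 2 + v t ^ 2) volume 0 1)
    {X Y ρ : ℝ → ℝ} (hX : X = fun t => x₀ + ∫ s in (0:ℝ)..t, u s)
    (hY : Y = fun t => y₀ + ∫ s in (0:ℝ)..t, v s)
    (hρ : ρ = fun t => √(X t ^ 2 + Y t ^ 2))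
    (hinv : IntervalIntegrable (fun t => (ρ t)⁻¹) volume 0 1)
    (hne : ∀ᵐ t, t ∈ uIcc (0:ℝ) 1 → ρ t ≠ 0)
    {φ ex ey : ℝ} (hφ : 0 ≤ φ) (hφπ : φ ≤ π) (he : ex ^ 2 + ey ^ 2 = 1)
    (h0 : ρ 0 ≤ ex * X 0 + ey * Y 0) (h1 : ex * X 1 + ey * Y 1 ≤ ρ 1 * cos φ) :
    φ ^ 2 ≤ (∫ t in (0:ℝ)..1, (ρ t)⁻¹) ^ 2 * ∫ t in (0:ℝ)..1, (u t ^ 2 + v t ^ 2) := by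
  have hρ0 : ∀ t, 0 ≤ ρ t := fun t => by rw [hρ]; positivity
  rcases hφ.eq_or_lt with rfl | hφ
  · have := intervalIntegral.integral_nonneg (μ := volume) (zero_le_one (α := ℝ))
      (f := fun t => u t ^ 2 + v t ^ 2) fun t _ => by positivity
    simpa using mul_nonneg (sq_nonneg _) this
  have hlim : Filter.Tendsto (fun δ : ℝ => ((φ - δ) - δ) ^ 2) (nhdsWithin 0 (Ioi 0))
      (nhds (φ ^ 2)) := by
    have : ContinuousAt (fun δ : ℝ => ((φ - δ) - δ) ^ 2) 0 := by fun_prop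
    have h := this.tendsto
    simp only [sub_zero] at h
    exact h.mono_left nhdsWithin_le_nhds
  refine le_of_tendsto hlim ?_
  filter_upwards [Ioo_mem_nhdsGT (show (0:ℝ) < φ / 2 by linarith)] with δ hδ
  refine sq_sub_le_of_boundary_angles x₀ y₀ hu hv hsq hX hY hρ hinv hne hδ.1
    (by linarith [hδ.2]) (by linarith [hδ.1]) he ?_ ?_
  · exact (mul_le_of_le_one_right (hρ0 0) (cos_le_one _)).trans h0
  · refine h1.trans (mul_le_mul_of_nonneg_left ?_ (hρ0 1))
    exact cos_le_cos_of_nonneg_of_le_pi (by linarith [hδ.2]) hφπ (by linarith [hδ.1])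

theorem rpow_two_thirds_pow_three {x : ℝ} (hx : 0 ≤ x) : (x ^ ((2:ℝ)/3)) ^ 3 = x ^ 2 := by
  rw [← Real.rpow_natCast, ← Real.rpow_mul hx, ← Real.rpow_natCast]
  norm_num

theorem mul_rpow_le_of_sq_le {φ S V : ℝ} (hφ : 0 ≤ φ) (hS : 0 ≤ S) (hV : 0 ≤ V)
    (h : φ ^ 2 ≤ S ^ 2 * V) :
    (3/8) * (16:ℝ) ^ ((1:ℝ)/3) * φ ^ ((2:ℝ)/3) ≤ V / 8 + S := by
  have ha : ((16:ℝ) ^ ((1:ℝ)/3)) ^ 3 = 16 := by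
    rw [← Real.rpow_natCast, ← Real.rpow_mul (by norm_num)]
    norm_num
  have hc := rpow_two_thirds_pow_three hφ
  refine le_of_pow_le_pow_left₀ three_ne_zero (by positivity) ?_
  rw [mul_pow, mul_pow, ha, hc]
  have : 0 ≤ (V / 8 - S / 2) ^ 2 * (V / 8 + 4 * S) := by positivity
  nlinarith

theorem sq_div_sq_norm_eq_one {z : ℂ} (hz : z ≠ 0) : (z.re / ‖z‖) ^ 2 + (z.im / ‖z‖) ^ 2 = 1 := by
  have h := Complex.sq_norm_sub_sq_re z
  have : ‖z‖ ≠ 0 := norm_ne_zero_iff.2 hz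
  field_simp
  linarith

/-- The unsigned angle between `z₀` and `z₁` expressed through `w = z₁ * conj z₀`, with the
convention that it is `π` when one of the two vectors vanishes. -/
def sweepAngle (w : ℂ) : ℝ := if w = 0 then π else |w.arg|

theorem sweepAngle_zero : sweepAngle 0 = π := if_pos rfl

theorem sweepAngle_nonneg (w : ℂ) : 0 ≤ sweepAngle w := by
  unfold sweepAngle; split_ifs <;> positivity

theorem sweepAngle_le_pi (w : ℂ) : sweepAngle w ≤ π := by
  unfold sweepAngle; split_ifs
  · exact le_rfl
  · exact Complex.abs_arg_le_pi w

theorem sweepAngle_mul_le (w z : ℂ) : sweepAngle (w * z) ≤ sweepAngle w + sweepAngle z := by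
  by_cases hw : w = 0
  · simpa [hw, sweepAngle_zero] using sweepAngle_nonneg z
  by_cases hz : z = 0
  · simpa [hz, sweepAngle_zero] using sweepAngle_nonneg w
  have h := InnerProductGeometry.angle_le_angle_add_angle (w * z) z 1
  rw [Complex.angle_eq_abs_arg (mul_ne_zero hw hz) one_ne_zero,
    Complex.angle_eq_abs_arg (mul_ne_zero hw hz) hz, Complex.angle_eq_abs_arg hz one_ne_zero,
    mul_div_cancel_right₀ _ hz, div_one, div_one] at h
  simpa [sweepAngle, hw, hz] using h

theorem le_sweepAngle_of_eq {w : ℂ} {r α : ℝ} (hr : 0 ≤ r) (hα0 : 0 ≤ α) (hα : α ≤ π)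
    (h : w = r * (cos α + sin α * Complex.I)) : α ≤ sweepAngle w := by
  rcases hr.eq_or_lt with rfl | hr
  · rw [h]; simpa [sweepAngle_zero] using hα
  · unfold sweepAngle
    split_ifs
    · exact hα
    · rw [h, Complex.ofReal_cos, Complex.ofReal_sin,
        Complex.arg_mul_cos_add_sin_mul_I hr ⟨by linarith [pi_pos], hα⟩]
      exact le_abs_self α

theorem exists_direction_of_sweepAngle (z₀ z₁ : ℂ) :
    ∃ ex ey : ℝ, ex ^ 2 + ey ^ 2 = 1 ∧ ‖z₀‖ ≤ ex * z₀.re + ey * z₀.im ∧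
      ex * z₁.re + ey * z₁.im ≤ ‖z₁‖ * cos (sweepAngle (z₁ * (starRingEnd ℂ) z₀)) := by
  have hsq : ∀ z : ℂ, z.re ^ 2 + z.im ^ 2 = ‖z‖ ^ 2 := fun z => by
    linarith [Complex.sq_norm_sub_sq_re z]
  by_cases h0 : z₀ = 0
  · by_cases h1 : z₁ = 0
    · exact ⟨1, 0, by norm_num, by simp [h0], by simp [h1]⟩
    · have hn : ‖z₁‖ ≠ 0 := norm_ne_zero_iff.2 h1
      refine ⟨-(z₁.re / ‖z₁‖), -(z₁.im / ‖z₁‖), ?_, by simp [h0], ?_⟩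
      · rw [neg_sq, neg_sq, sq_div_sq_norm_eq_one h1]
      · rw [h0, map_zero, mul_zero, sweepAngle_zero, cos_pi]
        have := hsq z₁
        field_simp
        linarith
  · have hn : ‖z₀‖ ≠ 0 := norm_ne_zero_iff.2 h0
    refine ⟨z₀.re / ‖z₀‖, z₀.im / ‖z₀‖, sq_div_sq_norm_eq_one h0, ?_, ?_⟩
    · have := hsq z₀
      field_simp
      linarith
    · by_cases h1 : z₁ = 0
      · simp [h1]
      have hw : z₁ * (starRingEnd ℂ) z₀ ≠ 0 :=
        mul_ne_zero h1 ((map_ne_zero _).2 h0)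
      have hn1 : ‖z₁‖ ≠ 0 := norm_ne_zero_iff.2 h1
      rw [sweepAngle, if_neg hw, cos_abs, Complex.cos_arg hw, norm_mul, Complex.norm_conj,
        Complex.mul_re, Complex.conj_re, Complex.conj_im]
      apply le_of_eq
      field_simp
      ring

theorem enorm2_sq (v : ℝ × ℝ) : enorm2 v ^ 2 = v.1 ^ 2 + v.2 ^ 2 :=
  Real.sq_sqrt (by positivity)

/-- Relative position of bodies `i` and `j` at time `t`, as a complex number. -/
def H1Path4.rel (p : H1Path4) (i j : Fin 4) (t : ℝ) : ℂ :=
  ⟨(p.q t i - p.q t j).1, (p.q t i - p.q t j).2⟩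

theorem H1Path4.norm_rel (p : H1Path4) (i j : Fin 4) (t : ℝ) :
    ‖p.rel i j t‖ = enorm2 (p.q t i - p.q t j) := by
  rw [Complex.norm_eq_sqrt_sq_add_sq]; rfl

/-- The contribution of the pair `i, j` to the action. -/
def pairAction (p : H1Path4) (i j : Fin 4) : ℝ≥0∞ :=
  ∫⁻ t in Icc (0:ℝ) 1, (ENNReal.ofReal ((1/8) * enorm2 (p.v t i - p.v t j) ^ 2)
    + (ENNReal.ofReal (enorm2 (p.q t i - p.q t j)))⁻¹)

/-- Angle swept by the relative position of the pair `i, j` between the endpoints. -/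
def H1Path4.sweep (p : H1Path4) (i j : Fin 4) : ℝ :=
  sweepAngle (p.rel i j 1 * (starRingEnd ℂ) (p.rel i j 0))

theorem le_pairAction (p : H1Path4) (i j : Fin 4) :
    ENNReal.ofReal ((3/8) * (16:ℝ) ^ ((1:ℝ)/3) * (p.sweep i j) ^ ((2:ℝ)/3))
      ≤ pairAction p i j := by
  set u : ℝ → ℝ := fun t => (p.v t i - p.v t j).1 with hu_def
  set v : ℝ → ℝ := fun t => (p.v t i - p.v t j).2 with hv_def
  set X : ℝ → ℝ := fun t => (p.rel i j 0).re + ∫ s in (0:ℝ)..t, u s with hX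
  set Y : ℝ → ℝ := fun t => (p.rel i j 0).im + ∫ s in (0:ℝ)..t, v s with hY
  set ρ : ℝ → ℝ := fun t => √(X t ^ 2 + Y t ^ 2) with hρ
  have hv1 : ∀ i, IntegrableOn (fun t => (p.v t i).1) (Icc 0 1) := fun i => (p.hvInt i).fst
  have hv2 : ∀ i, IntegrableOn (fun t => (p.v t i).2) (Icc 0 1) := fun i => (p.hvInt i).snd
  have toI : ∀ {f : ℝ → ℝ}, IntegrableOn f (Icc 0 1) → IntervalIntegrable f volume 0 1 :=
    fun h => (intervalIntegrable_iff_integrableOn_Icc_of_le zero_le_one).2 h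
  have huI : IntegrableOn u (Icc 0 1) := (hv1 i).sub (hv1 j)
  have hvI : IntegrableOn v (Icc 0 1) := (hv2 i).sub (hv2 j)
  have hvec : ∀ i, ∀ t ∈ Icc (0:ℝ) 1, IntervalIntegrable (fun s => p.v s i) volume 0 t := by
    intro i t ht
    refine (intervalIntegrable_iff_integrableOn_Icc_of_le ht.1).2 ?_
    exact (p.hvInt i).mono_set (Icc_subset_Icc_right ht.2)
  have hXY : ∀ t ∈ Icc (0:ℝ) 1, X t = (p.rel i j t).re ∧ Y t = (p.rel i j t).im := by
    intro t ht
    have e : p.q t i - p.q t j =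
        (p.q 0 i - p.q 0 j) + ∫ s in (0:ℝ)..t, (p.v s i - p.v s j) := by
      rw [p.hrep i t ht, p.hrep j t ht, intervalIntegral.integral_sub (hvec i t ht) (hvec j t ht)]
      abel
    have hI : IntervalIntegrable (fun s => p.v s i - p.v s j) volume 0 t :=
      (hvec i t ht).sub (hvec j t ht)
    have e1 : (∫ s in (0:ℝ)..t, (p.v s i - p.v s j)).1 = ∫ s in (0:ℝ)..t, u s :=
      ((ContinuousLinearMap.fst ℝ ℝ ℝ).intervalIntegral_comp_comm hI).symm
    have e2 : (∫ s in (0:ℝ)..t, (p.v s i - p.v s j)).2 = ∫ s in (0:ℝ)..t, v s :=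
      ((ContinuousLinearMap.snd ℝ ℝ ℝ).intervalIntegral_comp_comm hI).symm
    simp only [H1Path4.rel, hX, hY]
    rw [e, Prod.fst_add, Prod.snd_add, e1, e2]
    exact ⟨rfl, rfl⟩
  have hρe : ∀ t ∈ Icc (0:ℝ) 1, ρ t = enorm2 (p.q t i - p.q t j) := by
    intro t ht
    simp only [hρ]
    rw [(hXY t ht).1, (hXY t ht).2]
    rfl
  have hρn : ∀ t ∈ Icc (0:ℝ) 1, ρ t = ‖p.rel i j t‖ := fun t ht => by
    rw [hρe t ht, p.norm_rel]
  have hρ0 : ∀ t, 0 ≤ ρ t := fun t => Real.sqrt_nonneg _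
  have hsqI : IntegrableOn (fun t => u t ^ 2 + v t ^ 2) (Icc 0 1) := by
    have hdom : IntegrableOn (fun t => 2 * enorm2 (p.v t i) ^ 2 + 2 * enorm2 (p.v t j) ^ 2)
      (Icc 0 1) := ((p.hL2 i).const_mul 2).add ((p.hL2 j).const_mul 2)
    refine hdom.mono' ((huI.aestronglyMeasurable.pow 2).add (hvI.aestronglyMeasurable.pow 2)) ?_
    refine .of_forall fun t => ?_
    rw [Real.norm_of_nonneg (by positivity), enorm2_sq, enorm2_sq]
    simp only [hu_def, hv_def, Prod.fst_sub, Prod.snd_sub]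
    nlinarith [sq_nonneg ((p.v t i).1 + (p.v t j).1), sq_nonneg ((p.v t i).2 + (p.v t j).2)]
  have hcont : ContinuousOn ρ (Icc 0 1) := by
    have h := uIcc_of_le (zero_le_one (α := ℝ))
    have cX : ContinuousOn X (Icc 0 1) := by
      rw [← h]
      exact continuousOn_const.add
        (intervalIntegral.continuousOn_primitive_interval (by rwa [h]))
    have cY : ContinuousOn Y (Icc 0 1) := by
      rw [← h]
      exact continuousOn_const.add
        (intervalIntegral.continuousOn_primitive_interval (by rwa [h]))
    exact ((cX.pow 2).add (cY.pow 2)).sqrt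
  have hmeas : AEMeasurable ρ (volume.restrict (Icc 0 1)) := hcont.aemeasurable measurableSet_Icc
  have hPA : pairAction p i j = ∫⁻ t in Icc (0:ℝ) 1,
      (ENNReal.ofReal ((1/8) * (u t ^ 2 + v t ^ 2)) + (ENNReal.ofReal (ρ t))⁻¹) := by
    refine setLIntegral_congr_fun measurableSet_Icc fun t ht => ?_
    simp only [hρe t ht, enorm2_sq, hu_def, hv_def]
  rw [hPA]
  by_cases hfin : ∫⁻ t in Icc (0:ℝ) 1, (ENNReal.ofReal (ρ t))⁻¹ = ⊤
  · have : (⊤ : ℝ≥0∞) ≤ ∫⁻ t in Icc (0:ℝ) 1,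
        (ENNReal.ofReal ((1/8) * (u t ^ 2 + v t ^ 2)) + (ENNReal.ofReal (ρ t))⁻¹) := by
      rw [← hfin]
      exact lintegral_mono fun t => le_add_self
    exact le_top.trans this
  have hpos : ∀ᵐ t ∂volume.restrict (Icc (0:ℝ) 1), 0 < ρ t := by
    filter_upwards [ae_lt_top' hmeas.ennreal_ofReal.inv hfin] with t ht
    simpa using ht
  have hinvE : ∀ᵐ t ∂volume.restrict (Icc (0:ℝ) 1),
      (ENNReal.ofReal (ρ t))⁻¹ = ENNReal.ofReal (ρ t)⁻¹ := by
    filter_upwards [hpos] with t ht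
    rw [ENNReal.ofReal_inv_of_pos ht]
  have hinvI : IntegrableOn (fun t => (ρ t)⁻¹) (Icc 0 1) := by
    refine ⟨hmeas.inv.aestronglyMeasurable, ?_⟩
    rw [hasFiniteIntegral_iff_ofReal (.of_forall fun t => inv_nonneg.2 (hρ0 t)),
      ← lintegral_congr_ae hinvE]
    exact lt_top_iff_ne_top.2 hfin
  have hne : ∀ᵐ t, t ∈ uIcc (0:ℝ) 1 → ρ t ≠ 0 := by
    rw [uIcc_of_le zero_le_one]
    rw [ae_restrict_iff' measurableSet_Icc] at hpos
    filter_upwards [hpos] with t ht hmem using (ht hmem).ne'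
  have hsum : ∫⁻ t in Icc (0:ℝ) 1,
      (ENNReal.ofReal ((1/8) * (u t ^ 2 + v t ^ 2)) + (ENNReal.ofReal (ρ t))⁻¹) =
      ENNReal.ofReal ((∫ t in (0:ℝ)..1, (u t ^ 2 + v t ^ 2)) / 8 + ∫ t in (0:ℝ)..1, (ρ t)⁻¹) := by
    have e : (∫ t in (0:ℝ)..1, (u t ^ 2 + v t ^ 2)) / 8 + ∫ t in (0:ℝ)..1, (ρ t)⁻¹ =
        ∫ t in Icc (0:ℝ) 1, ((1/8) * (u t ^ 2 + v t ^ 2) + (ρ t)⁻¹) := by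
      rw [integral_Icc_eq_integral_Ioc, ← intervalIntegral.integral_of_le zero_le_one,
        intervalIntegral.integral_add ((toI hsqI).const_mul _) (toI hinvI),
        intervalIntegral.integral_const_mul]
      ring
    have hI : IntegrableOn (fun t => (1/8) * (u t ^ 2 + v t ^ 2) + (ρ t)⁻¹) (Icc 0 1) :=
      (hsqI.const_mul _).add hinvI
    rw [e, ofReal_integral_eq_lintegral_ofReal hI
      (.of_forall fun t => add_nonneg (by positivity) (inv_nonneg.2 (hρ0 t)))]
    refine lintegral_congr_ae ?_
    filter_upwards [hinvE] with t ht
    rw [ht, ENNReal.ofReal_add (by positivity) (inv_nonneg.2 (hρ0 t))]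
  rw [hsum]
  refine ENNReal.ofReal_le_ofReal ?_
  obtain ⟨ex, ey, he, h0, h1⟩ := exists_direction_of_sweepAngle (p.rel i j 0) (p.rel i j 1)
  have m0 : (0:ℝ) ∈ Icc (0:ℝ) 1 := by simp
  have m1 : (1:ℝ) ∈ Icc (0:ℝ) 1 := by simp
  refine mul_rpow_le_of_sq_le (sweepAngle_nonneg _)
    (intervalIntegral.integral_nonneg zero_le_one fun t _ => inv_nonneg.2 (hρ0 t))
    (intervalIntegral.integral_nonneg zero_le_one fun t _ => by positivity) ?_
  refine sq_le_of_boundary_angle _ _ (toI huI) (toI hvI) (toI hsqI) hX hY hρ (toI hinvI) hne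
    (sweepAngle_nonneg _) (sweepAngle_le_pi _) he ?_ ?_
  · rw [hρn 0 m0, (hXY 0 m0).1, (hXY 0 m0).2]; exact h0
  · rw [hρn 1 m1, (hXY 1 m1).1, (hXY 1 m1).2]; exact h1

theorem sum_pairAction_le_action (p : H1Path4) :
    pairAction p 0 1 + pairAction p 2 3 + pairAction p 0 2 + pairAction p 1 3 + pairAction p 0 3
      + pairAction p 1 2 ≤ action p := by
  unfold pairAction action
  refine (add_le_add_left (add_le_add_left (add_le_add_left (add_le_add_left
    (le_lintegral_add _ _) _) _) _) _).trans ?_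
  refine (add_le_add_left (add_le_add_left (add_le_add_left (le_lintegral_add _ _) _) _) _).trans ?_
  refine (add_le_add_left (add_le_add_left (le_lintegral_add _ _) _) _).trans ?_
  refine (add_le_add_left (le_lintegral_add _ _) _).trans ?_
  refine (le_lintegral_add _ _).trans ?_
  refine lintegral_mono fun t => ?_
  have hf : ∀ P : Fin 4 → Fin 4 → ℝ≥0∞,
      ∑ i : Fin 4, ∑ j ∈ Finset.univ.filter (fun j => i < j), P i j =
      P 0 1 + P 2 3 + P 0 2 + P 1 3 + P 0 3 + P 1 2 := by
    intro P
    simp only [Finset.sum_filter, Fin.sum_univ_four]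
    simp
    ring
  simp only [hf]
  have hk : ENNReal.ofReal ((1/8) * enorm2 (p.v t 0 - p.v t 1) ^ 2)
      + ENNReal.ofReal ((1/8) * enorm2 (p.v t 2 - p.v t 3) ^ 2)
      + ENNReal.ofReal ((1/8) * enorm2 (p.v t 0 - p.v t 2) ^ 2)
      + ENNReal.ofReal ((1/8) * enorm2 (p.v t 1 - p.v t 3) ^ 2)
      + ENNReal.ofReal ((1/8) * enorm2 (p.v t 0 - p.v t 3) ^ 2)
      + ENNReal.ofReal ((1/8) * enorm2 (p.v t 1 - p.v t 2) ^ 2)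
      ≤ ENNReal.ofReal ((1/2) * ∑ i, enorm2 (p.v t i) ^ 2) := by
    rw [← ENNReal.ofReal_add, ← ENNReal.ofReal_add, ← ENNReal.ofReal_add, ← ENNReal.ofReal_add,
      ← ENNReal.ofReal_add]
    any_goals positivity
    refine ENNReal.ofReal_le_ofReal ?_
    simp only [enorm2_sq, Fin.sum_univ_four, Prod.fst_sub, Prod.snd_sub]
    nlinarith [sq_nonneg ((p.v t 0).1 + (p.v t 1).1 + (p.v t 2).1 + (p.v t 3).1),
      sq_nonneg ((p.v t 0).2 + (p.v t 1).2 + (p.v t 2).2 + (p.v t 3).2)]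
  refine le_trans (le_of_eq ?_) (add_le_add_left hk _)
  ring

theorem ofReal_sum_sweep_le_action (p : H1Path4) :
    ENNReal.ofReal ((3/8) * (16:ℝ) ^ ((1:ℝ)/3) *
      (p.sweep 0 1 ^ ((2:ℝ)/3) + p.sweep 2 3 ^ ((2:ℝ)/3) + p.sweep 0 2 ^ ((2:ℝ)/3)
        + p.sweep 1 3 ^ ((2:ℝ)/3) + p.sweep 0 3 ^ ((2:ℝ)/3) + p.sweep 1 2 ^ ((2:ℝ)/3)))
      ≤ action p := by
  refine le_trans ?_ (sum_pairAction_le_action p)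
  have hs : ∀ i j, 0 ≤ p.sweep i j := fun i j => sweepAngle_nonneg _
  have hpos : ∀ i j, 0 ≤ (3/8) * (16:ℝ) ^ ((1:ℝ)/3) * p.sweep i j ^ ((2:ℝ)/3) :=
    fun i j => mul_nonneg (by positivity) (Real.rpow_nonneg (hs i j) _)
  simp only [mul_add]
  refine ENNReal.ofReal_add_le.trans (add_le_add ?_ (le_pairAction p _ _))
  refine ENNReal.ofReal_add_le.trans (add_le_add ?_ (le_pairAction p _ _))
  refine ENNReal.ofReal_add_le.trans (add_le_add ?_ (le_pairAction p _ _))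
  refine ENNReal.ofReal_add_le.trans (add_le_add ?_ (le_pairAction p _ _))
  exact ENNReal.ofReal_add_le.trans (add_le_add (le_pairAction p _ _) (le_pairAction p _ _))

theorem rpow_two_thirds_le_add {x a b : ℝ} (hx : 0 ≤ x) (ha : 0 ≤ a) (hb : 0 ≤ b)
    (h : x ≤ a + b) : x ^ ((2:ℝ)/3) ≤ a ^ ((2:ℝ)/3) + b ^ ((2:ℝ)/3) :=
  (Real.rpow_le_rpow hx h (by norm_num)).trans
    (Real.rpow_add_le_add_rpow ha hb (by norm_num) (by norm_num))

theorem rpow_theta_add_rpow_two_theta_le {θ : ℝ} (hθ0 : 0 < θ) (hθ1 : θ ≤ π / 10) :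
    θ ^ ((2:ℝ)/3) + (2*θ) ^ ((2:ℝ)/3) ≤ (π/2 + θ) ^ ((2:ℝ)/3) := by
  have h1 := rpow_two_thirds_pow_three hθ0.le
  have h2 := rpow_two_thirds_pow_three (show 0 ≤ 2 * θ by linarith)
  have h3 := rpow_two_thirds_pow_three (show 0 ≤ π/2 + θ by linarith [pi_pos])
  have h6 : 6 * θ ≤ π/2 + θ := by linarith
  have hv : (2*θ) ^ ((2:ℝ)/3) ≤ 2 * θ ^ ((2:ℝ)/3) := by
    refine le_of_pow_le_pow_left₀ three_ne_zero (by positivity) ?_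
    rw [mul_pow, h1, h2]
    nlinarith [sq_nonneg θ]
  have hw : 3 * θ ^ ((2:ℝ)/3) ≤ (π/2 + θ) ^ ((2:ℝ)/3) := by
    refine le_of_pow_le_pow_left₀ three_ne_zero (by positivity) ?_
    rw [mul_pow, h1, h3]
    nlinarith [sq_nonneg θ]
  linarith

theorem le_sum_rpow_of_angle_bounds {θ s₁₂ s₃₄ s₁₃ s₂₄ s₁₄ s₂₃ : ℝ}
    (hθ0 : 0 < θ) (hθ1 : θ ≤ π / 10)
    (h₁₃ : 0 ≤ s₁₃) (h₂₄ : 0 ≤ s₂₄) (h₁₄ : 0 ≤ s₁₄) (h₂₃ : 0 ≤ s₂₃)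
    (hs₁₂ : π / 2 + θ ≤ s₁₂) (hs₃₄ : θ ≤ s₃₄) (hsum : 4 * θ ≤ s₁₃ + s₂₄ + (s₁₄ + s₂₃))
    (hcase : (π ≤ s₁₂ ∧ ((2 * θ ≤ s₁₃ + s₂₄ ∧ 2 * θ ≤ s₁₄ + s₂₃) ∨
        (2 * θ ≤ s₁₃ + s₁₄ ∧ 2 * θ ≤ s₂₄ + s₂₃))) ∨ π ≤ s₃₄ ∨ (π ≤ s₁₄ ∧ π ≤ s₂₃)) :
    π ^ ((2:ℝ)/3) + θ ^ ((2:ℝ)/3) + 2 * (2*θ) ^ ((2:ℝ)/3) ≤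
      s₁₂ ^ ((2:ℝ)/3) + s₃₄ ^ ((2:ℝ)/3) + s₁₃ ^ ((2:ℝ)/3) + s₂₄ ^ ((2:ℝ)/3) + s₁₄ ^ ((2:ℝ)/3)
        + s₂₃ ^ ((2:ℝ)/3) := by
  have hπ := pi_pos
  have mono : ∀ {x y : ℝ}, 0 ≤ x → x ≤ y → x ^ ((2:ℝ)/3) ≤ y ^ ((2:ℝ)/3) :=
    fun hx h => Real.rpow_le_rpow hx h (by norm_num)
  have p₁₃ := Real.rpow_nonneg h₁₃ ((2:ℝ)/3)
  have p₂₄ := Real.rpow_nonneg h₂₄ ((2:ℝ)/3)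
  have m₃₄ := mono hθ0.le hs₃₄
  have m₁₂ := mono (by linarith) hs₁₂
  rcases hcase with ⟨hπs, ⟨ha, hb⟩ | ⟨ha, hb⟩⟩ | hπs | ⟨hπa, hπb⟩
  · have := mono hπ.le hπs
    have ea := rpow_two_thirds_le_add (by linarith) h₁₃ h₂₄ ha
    have eb := rpow_two_thirds_le_add (by linarith) h₁₄ h₂₃ hb
    linarith
  · have := mono hπ.le hπs
    have ea := rpow_two_thirds_le_add (by linarith) h₁₃ h₁₄ ha
    have eb := rpow_two_thirds_le_add (by linarith) h₂₄ h₂₃ hb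
    linarith
  · have := mono hπ.le hπs
    have e := rpow_two_thirds_le_add (by linarith) (add_nonneg h₁₃ h₂₄) (add_nonneg h₁₄ h₂₃) hsum
    have ea := rpow_two_thirds_le_add (add_nonneg h₁₃ h₂₄) h₁₃ h₂₄ le_rfl
    have eb := rpow_two_thirds_le_add (add_nonneg h₁₄ h₂₃) h₁₄ h₂₃ le_rfl
    have m4 := mono (by linarith) (show 2 * θ ≤ 4 * θ by linarith)
    have := rpow_theta_add_rpow_two_theta_le hθ0 hθ1
    linarith
  · have ea := mono hπ.le hπa
    have eb := mono hπ.le hπb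
    have m2 := mono (by linarith) (show 2 * θ ≤ π by linarith)
    have m3 := mono (by linarith) (show 2 * θ ≤ π / 2 + θ by linarith)
    linarith

theorem rotV_injective (θ : ℝ) : Function.Injective (rotV θ) := by
  intro v w h
  have h1 : v.1 * cos θ - v.2 * sin θ = w.1 * cos θ - w.2 * sin θ := congrArg Prod.fst h
  have h2 : v.1 * sin θ + v.2 * cos θ = w.1 * sin θ + w.2 * cos θ := congrArg Prod.snd h
  have hcs := sin_sq_add_cos_sq θ
  refine Prod.ext ?_ ?_
  · linear_combination cos θ * h1 + sin θ * h2 - (v.1 - w.1) * hcs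
  · linear_combination -sin θ * h1 + cos θ * h2 - (v.2 - w.2) * hcs

theorem H1Path4.sweep_eq_pi_of_eq (p : H1Path4) {i j : Fin 4} {t : ℝ} (ht : t = 0 ∨ t = 1)
    (h : p.q t i = p.q t j) : p.sweep i j = π := by
  have : p.rel i j t = 0 := by simp [H1Path4.rel, h, Complex.ext_iff]
  rcases ht with rfl | rfl <;> simp [H1Path4.sweep, this, sweepAngle_zero]

theorem H1Path4.le_sweep_add_sweep (p : H1Path4) {i j k l : Fin 4} {r α : ℝ} (hr : 0 ≤ r)
    (hα0 : 0 ≤ α) (hα : α ≤ π)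
    (h : (p.rel i j 1 * (starRingEnd ℂ) (p.rel i j 0)) *
      (p.rel k l 1 * (starRingEnd ℂ) (p.rel k l 0)) = r * (cos α + sin α * Complex.I)) :
    α ≤ p.sweep i j + p.sweep k l :=
  (le_sweepAngle_of_eq hr hα0 hα h).trans (sweepAngle_mul_le _ _)

theorem sweep_bounds {θ : ℝ} (hθ0 : 0 < θ) (hθ1 : θ ≤ π / 10) (p : H1Path4)
    (h0 : p.q 0 ∈ QSset) (h1 : p.q 1 ∈ QE2set θ)
    (hcol : ∃ t₀ ∈ ({0, 1} : Set ℝ), ∃ i j : Fin 4, i ≠ j ∧ p.q t₀ i = p.q t₀ j) :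
    π / 2 + θ ≤ p.sweep 0 1 ∧ θ ≤ p.sweep 2 3 ∧
    4 * θ ≤ p.sweep 0 2 + p.sweep 1 3 + (p.sweep 0 3 + p.sweep 1 2) ∧
    ((π ≤ p.sweep 0 1 ∧ ((2 * θ ≤ p.sweep 0 2 + p.sweep 1 3 ∧ 2 * θ ≤ p.sweep 0 3 + p.sweep 1 2) ∨
        (2 * θ ≤ p.sweep 0 2 + p.sweep 0 3 ∧ 2 * θ ≤ p.sweep 1 3 + p.sweep 1 2))) ∨
      π ≤ p.sweep 2 3 ∨ (π ≤ p.sweep 0 3 ∧ π ≤ p.sweep 1 2)) := by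
  obtain ⟨a₁, b₁, c₁, hb₁, hc₁, h0⟩ := h0
  obtain ⟨a₂, b₂, c₂, hb₂, hc₂, h1⟩ := h1
  have hπ := pi_pos
  have hs2 := sin_two_mul θ
  have hc2 := cos_two_mul' θ
  have R01 : p.rel 0 1 0 = ⟨-c₁, 0⟩ := by
    simp [H1Path4.rel, h0, Complex.ext_iff]; ring
  have R23 : p.rel 2 3 0 = ⟨0, 2 * b₁⟩ := by
    simp [H1Path4.rel, h0, Complex.ext_iff]; ring
  have R02 : p.rel 0 2 0 = ⟨-(2 * a₁ + 3 / 2 * c₁), -b₁⟩ := by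
    simp [H1Path4.rel, h0, Complex.ext_iff]; ring
  have R03 : p.rel 0 3 0 = ⟨-(2 * a₁ + 3 / 2 * c₁), b₁⟩ := by
    simp [H1Path4.rel, h0, Complex.ext_iff]; ring
  have R12 : p.rel 1 2 0 = ⟨-(2 * a₁ + 1 / 2 * c₁), -b₁⟩ := by
    simp [H1Path4.rel, h0, Complex.ext_iff]; ring
  have R13 : p.rel 1 3 0 = ⟨-(2 * a₁ + 1 / 2 * c₁), b₁⟩ := by
    simp [H1Path4.rel, h0, Complex.ext_iff]; ring
  have E01 : p.rel 0 1 1 = ⟨0, -(2 * b₂)⟩ * ⟨cos θ, sin θ⟩ := by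
    simp [H1Path4.rel, h1, Complex.ext_iff, rotV]; constructor <;> ring
  have E23 : p.rel 2 3 1 = ⟨0, 2 * c₂⟩ * ⟨cos θ, sin θ⟩ := by
    simp [H1Path4.rel, h1, Complex.ext_iff, rotV]; constructor <;> ring
  have E02 : p.rel 0 2 1 = ⟨-(2 * a₂), -b₂ - c₂⟩ * ⟨cos θ, sin θ⟩ := by
    simp [H1Path4.rel, h1, Complex.ext_iff, rotV]; constructor <;> ring
  have E03 : p.rel 0 3 1 = ⟨-(2 * a₂), -b₂ + c₂⟩ * ⟨cos θ, sin θ⟩ := by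
    simp [H1Path4.rel, h1, Complex.ext_iff, rotV]; constructor <;> ring
  have E12 : p.rel 1 2 1 = ⟨-(2 * a₂), b₂ - c₂⟩ * ⟨cos θ, sin θ⟩ := by
    simp [H1Path4.rel, h1, Complex.ext_iff, rotV]; constructor <;> ring
  have E13 : p.rel 1 3 1 = ⟨-(2 * a₂), b₂ + c₂⟩ * ⟨cos θ, sin θ⟩ := by
    simp [H1Path4.rel, h1, Complex.ext_iff, rotV]; constructor <;> ring
  have e2 : (⟨cos θ, sin θ⟩ : ℂ) * ⟨cos θ, sin θ⟩ = ⟨cos (2 * θ), sin (2 * θ)⟩ := by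
    rw [hs2, hc2]; apply Complex.ext <;> simp <;> ring
  have e4 : (⟨cos (2 * θ), sin (2 * θ)⟩ : ℂ) * ⟨cos (2 * θ), sin (2 * θ)⟩ =
      ⟨cos (4 * θ), sin (4 * θ)⟩ := by
    rw [show 4 * θ = 2 * (2 * θ) by ring, sin_two_mul (2 * θ), cos_two_mul' (2 * θ)]
    apply Complex.ext <;> simp <;> ring
  have polar : ∀ α : ℝ, ((cos α : ℝ) : ℂ) + (sin α : ℝ) * Complex.I = ⟨cos α, sin α⟩ :=
    fun α => Complex.ext (by simp [-Complex.ofReal_cos, -Complex.ofReal_sin])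
      (by simp [-Complex.ofReal_cos, -Complex.ofReal_sin])
  -- the relations between the four cross pairs that hold for every admissible configuration
  have end_13_24 : p.rel 0 2 1 * p.rel 1 3 1 =
      (((2 * a₂) ^ 2 + (b₂ + c₂) ^ 2 : ℝ) : ℂ) * ⟨cos (2 * θ), sin (2 * θ)⟩ := by
    rw [E02, E13, ← e2]; apply Complex.ext <;> simp only [Complex.mul_re, Complex.mul_im, Complex.ofReal_re,
      Complex.ofReal_im] <;> ring
  have end_14_23 : p.rel 0 3 1 * p.rel 1 2 1 =
      (((2 * a₂) ^ 2 + (b₂ - c₂) ^ 2 : ℝ) : ℂ) * ⟨cos (2 * θ), sin (2 * θ)⟩ := by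
    rw [E03, E12, ← e2]; apply Complex.ext <;> simp only [Complex.mul_re, Complex.mul_im, Complex.ofReal_re,
      Complex.ofReal_im] <;> ring
  have start_13_14 : p.rel 0 2 0 * p.rel 0 3 0 =
      (((2 * a₁ + 3 / 2 * c₁) ^ 2 + b₁ ^ 2 : ℝ) : ℂ) := by
    rw [R02, R03]; apply Complex.ext <;> simp only [Complex.mul_re, Complex.mul_im, Complex.ofReal_re,
      Complex.ofReal_im] <;> ring
  have start_24_23 : p.rel 1 3 0 * p.rel 1 2 0 =
      (((2 * a₁ + 1 / 2 * c₁) ^ 2 + b₁ ^ 2 : ℝ) : ℂ) := by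
    rw [R13, R12]; apply Complex.ext <;> simp only [Complex.mul_re, Complex.mul_im, Complex.ofReal_re,
      Complex.ofReal_im] <;> ring
  have group : ∀ i j k l : Fin 4,
      (p.rel i j 1 * (starRingEnd ℂ) (p.rel i j 0)) *
      (p.rel k l 1 * (starRingEnd ℂ) (p.rel k l 0)) =
      (p.rel i j 1 * p.rel k l 1) * (starRingEnd ℂ) (p.rel i j 0 * p.rel k l 0) := by
    intro i j k l; rw [map_mul]; ring
  refine ⟨?_, ?_, ?_, ?_⟩
  · refine le_sweepAngle_of_eq (r := 2 * b₂ * c₁) (by positivity) (by linarith) (by linarith) ?_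
    rw [polar, add_comm, cos_add_pi_div_two, sin_add_pi_div_two, E01, R01]
    apply Complex.ext <;> simp only [Complex.mul_re, Complex.mul_im, Complex.ofReal_re,
      Complex.ofReal_im, Complex.conj_re, Complex.conj_im] <;> ring
  · refine le_sweepAngle_of_eq (r := 4 * c₂ * b₁) (by positivity) hθ0.le (by linarith) ?_
    rw [polar, E23, R23]
    apply Complex.ext <;> simp only [Complex.mul_re, Complex.mul_im, Complex.ofReal_re,
      Complex.ofReal_im, Complex.conj_re, Complex.conj_im] <;> ring
  · have hprod : ((p.rel 0 2 1 * (starRingEnd ℂ) (p.rel 0 2 0)) *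
        (p.rel 1 3 1 * (starRingEnd ℂ) (p.rel 1 3 0))) *
        ((p.rel 0 3 1 * (starRingEnd ℂ) (p.rel 0 3 0)) *
        (p.rel 1 2 1 * (starRingEnd ℂ) (p.rel 1 2 0))) =
        ((((2 * a₂) ^ 2 + (b₂ + c₂) ^ 2) * ((2 * a₂) ^ 2 + (b₂ - c₂) ^ 2) *
          (((2 * a₁ + 3 / 2 * c₁) ^ 2 + b₁ ^ 2) * ((2 * a₁ + 1 / 2 * c₁) ^ 2 + b₁ ^ 2)) : ℝ) : ℂ) *
          (cos (4 * θ) + sin (4 * θ) * Complex.I) := by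
      calc _ = (p.rel 0 2 1 * p.rel 1 3 1) * (p.rel 0 3 1 * p.rel 1 2 1) *
            ((starRingEnd ℂ) (p.rel 0 2 0 * p.rel 0 3 0) *
              (starRingEnd ℂ) (p.rel 1 3 0 * p.rel 1 2 0)) := by
            simp only [map_mul]; ring
        _ = _ := by
            rw [end_13_24, end_14_23, start_13_14, start_24_23, polar, ← e4,
              Complex.conj_ofReal, Complex.conj_ofReal]
            push_cast
            ring
    have h := le_sweepAngle_of_eq (by positivity) (by linarith) (by linarith) hprod
    exact (h.trans (sweepAngle_mul_le _ _)).trans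
      (add_le_add (sweepAngle_mul_le _ _) (sweepAngle_mul_le _ _))
  · -- collisions of the first two bodies
    have case_c₁ : c₁ = 0 → π ≤ p.sweep 0 1 ∧
        ((2 * θ ≤ p.sweep 0 2 + p.sweep 1 3 ∧ 2 * θ ≤ p.sweep 0 3 + p.sweep 1 2) ∨
        (2 * θ ≤ p.sweep 0 2 + p.sweep 0 3 ∧ 2 * θ ≤ p.sweep 1 3 + p.sweep 1 2)) := by
      rintro rfl
      refine ⟨(p.sweep_eq_pi_of_eq (.inl rfl) (by simp [h0])).ge, .inl ⟨?_, ?_⟩⟩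
      · refine p.le_sweep_add_sweep (r := ((2 * a₂) ^ 2 + (b₂ + c₂) ^ 2) * ((2 * a₁) ^ 2 + b₁ ^ 2))
          (by positivity) (by linarith) (by linarith) ?_
        rw [group, end_13_24, polar, R02, R13]
        apply Complex.ext <;> simp only [Complex.mul_re, Complex.mul_im, Complex.ofReal_re,
      Complex.ofReal_im, Complex.conj_re, Complex.conj_im] <;> ring
      · refine p.le_sweep_add_sweep (r := ((2 * a₂) ^ 2 + (b₂ - c₂) ^ 2) * ((2 * a₁) ^ 2 + b₁ ^ 2))
          (by positivity) (by linarith) (by linarith) ?_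
        rw [group, end_14_23, polar, R03, R12]
        apply Complex.ext <;> simp only [Complex.mul_re, Complex.mul_im, Complex.ofReal_re,
      Complex.ofReal_im, Complex.conj_re, Complex.conj_im] <;> ring
    have case_b₂ : b₂ = 0 → π ≤ p.sweep 0 1 ∧
        ((2 * θ ≤ p.sweep 0 2 + p.sweep 1 3 ∧ 2 * θ ≤ p.sweep 0 3 + p.sweep 1 2) ∨
        (2 * θ ≤ p.sweep 0 2 + p.sweep 0 3 ∧ 2 * θ ≤ p.sweep 1 3 + p.sweep 1 2)) := by
      rintro rfl
      refine ⟨(p.sweep_eq_pi_of_eq (.inr rfl) (by simp [h1])).ge, .inr ⟨?_, ?_⟩⟩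
      · refine p.le_sweep_add_sweep
          (r := ((2 * a₂) ^ 2 + c₂ ^ 2) * ((2 * a₁ + 3 / 2 * c₁) ^ 2 + b₁ ^ 2))
          (by positivity) (by linarith) (by linarith) ?_
        rw [group, start_13_14, polar, E02, E03, ← e2]
        apply Complex.ext <;> simp only [Complex.mul_re, Complex.mul_im, Complex.ofReal_re,
      Complex.ofReal_im, Complex.conj_re, Complex.conj_im] <;> ring
      · refine p.le_sweep_add_sweep
          (r := ((2 * a₂) ^ 2 + c₂ ^ 2) * ((2 * a₁ + 1 / 2 * c₁) ^ 2 + b₁ ^ 2))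
          (by positivity) (by linarith) (by linarith) ?_
        rw [group, start_24_23, polar, E13, E12, ← e2]
        apply Complex.ext <;> simp only [Complex.mul_re, Complex.mul_im, Complex.ofReal_re,
      Complex.ofReal_im, Complex.conj_re, Complex.conj_im] <;> ring
    have case_b₁ : b₁ = 0 → π ≤ p.sweep 2 3 := by
      rintro rfl
      exact (p.sweep_eq_pi_of_eq (.inl rfl) (by simp [h0])).ge
    have case_c₂ : c₂ = 0 → π ≤ p.sweep 2 3 := by
      rintro rfl
      exact (p.sweep_eq_pi_of_eq (.inr rfl) (by simp [h1])).ge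
    have case_cross : a₂ = 0 → b₂ = c₂ → π ≤ p.sweep 0 3 ∧ π ≤ p.sweep 1 2 := by
      rintro rfl rfl
      exact ⟨(p.sweep_eq_pi_of_eq (.inr rfl) (by simp [h1])).ge,
        (p.sweep_eq_pi_of_eq (.inr rfl) (by simp [h1])).ge⟩
    have start_cases : ∀ i j : Fin 4, i < j → p.q 0 i = p.q 0 j → c₁ = 0 ∨ b₁ = 0 := by
      intro i j hij h
      rw [h0] at h
      fin_cases i <;> fin_cases j <;> simp at hij h <;>
        first | (left; linarith) | (right; linarith)
    have end_cases : ∀ i j : Fin 4, i < j → p.q 1 i = p.q 1 j →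
        b₂ = 0 ∨ c₂ = 0 ∨ (a₂ = 0 ∧ b₂ = c₂) := by
      intro i j hij h
      rw [h1] at h
      have h := rotV_injective θ h
      fin_cases i <;> fin_cases j <;> simp at hij h <;>
        first
          | (left; linarith)
          | (right; left; linarith)
          | (right; right; constructor <;> linarith)
    obtain ⟨t₀, ht₀, i, j, hij, h⟩ := hcol
    wlog hlt : i < j generalizing i j
    · exact this j i hij.symm h.symm (lt_of_le_of_ne (not_lt.1 hlt) hij.symm)
    rcases ht₀ with rfl | ht₀
    · rcases start_cases i j hlt h with h | h
      · exact .inl (case_c₁ h)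
      · exact .inr (.inl (case_b₁ h))
    · obtain rfl : t₀ = 1 := ht₀
      rcases end_cases i j hlt h with h | h | ⟨ha, hbc⟩
      · exact .inl (case_b₂ h)
      · exact .inr (.inl (case_c₂ h))
      · exact .inr (.inr (case_cross ha hbc))

/-- for `θ ∈ (0, π/10]`, an action minimizer over `P(Q_S, Q_{E₂})`
with a boundary collision has action at least
`(3/8)·16^{1/3}·[π^{2/3} + θ^{2/3} + 2(2θ)^{2/3}]`. -/
theorem statement14 (θ : ℝ) (hθ0 : 0 < θ) (hθ1 : θ ≤ π/10)
    (p : H1Path4) (hp : isMin (QE2set θ) p)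
    (hcol : ∃ t₀ ∈ ({0, 1} : Set ℝ), ∃ i j : Fin 4, i ≠ j ∧ p.q t₀ i = p.q t₀ j) :
    ENNReal.ofReal ((3/8) * (16:ℝ) ^ ((1:ℝ)/3) *
      (π ^ ((2:ℝ)/3) + θ ^ ((2:ℝ)/3) + 2 * (2*θ) ^ ((2:ℝ)/3))) ≤ action p := by
  obtain ⟨h12, h34, hsum, hcase⟩ := sweep_bounds hθ0 hθ1 p hp.1.2.1 hp.1.2.2 hcol
  refine le_trans (ENNReal.ofReal_le_ofReal ?_) (ofReal_sum_sweep_le_action p)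
  refine mul_le_mul_of_nonneg_left ?_ (by positivity)
  have hs : ∀ i j, 0 ≤ p.sweep i j := fun i j => sweepAngle_nonneg _
  exact le_sum_rpow_of_angle_bounds hθ0 hθ1 (hs _ _) (hs _ _) (hs _ _) (hs _ _) h12 h34 hsum hcase


end
end

section
/- Let a, b, c, d ∈ ℝ with a·d ≠ b·c. Then ∫₀¹ du / √((a+bu)² + (c+du)²) = (1/√(b²+d²)) · [ ln( (ab+cd)/(b²+d²) + 1 + √(((a+b)²+(c+d)²)/(b²+d²)) ) − ln( (ab+cd)/(b²+d²) + √((a²+c²)/(b²+d²)) ) ]. -/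
open Real

theorem add_sqrt_sq_add_pos {k : ℝ} (hk : 0 < k) (x : ℝ) : 0 < x + √(x ^ 2 + k) := by
  have h : |x| < √(x ^ 2 + k) := by
    rw [← Real.sqrt_sq_eq_abs]
    exact Real.sqrt_lt_sqrt (sq_nonneg x) (by linarith)
  linarith [neg_abs_le x]

theorem hasDerivAt_log_add_sqrt {k : ℝ} (hk : 0 < k) (x : ℝ) :
    HasDerivAt (fun y : ℝ => Real.log (y + √(y ^ 2 + k))) (1 / √(x ^ 2 + k)) x := by
  have hq : 0 < x ^ 2 + k := by positivity
  have hs : 0 < √(x ^ 2 + k) := Real.sqrt_pos.2 hq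
  have hp := add_sqrt_sq_add_pos hk x
  have hd : HasDerivAt (fun y : ℝ => y ^ 2 + k) (2 * x) x := by
    simpa using (hasDerivAt_pow 2 x).add_const k
  have hsum : HasDerivAt (fun y : ℝ => y + √(y ^ 2 + k)) (1 + 2 * x / (2 * √(x ^ 2 + k))) x :=
    (hasDerivAt_id' x).add (hd.sqrt hq.ne')
  convert hsum.log hp.ne' using 1
  field_simp
  ring

theorem integral_one_div_sqrt_sq_add {k : ℝ} (hk : 0 < k) (s t : ℝ) :
    ∫ x in s..t, 1 / √(x ^ 2 + k)
      = Real.log (t + √(t ^ 2 + k)) - Real.log (s + √(s ^ 2 + k)) := by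
  refine intervalIntegral.integral_eq_sub_of_hasDerivAt
    (fun x _ => hasDerivAt_log_add_sqrt hk x) (Continuous.intervalIntegrable ?_ s t)
  refine continuous_const.div (by fun_prop) fun x => ?_
  positivity

/-- closed form of `∫₀¹ du / √((a+bu)² + (c+du)²)` when `ad ≠ bc`. -/
theorem statement17 (a b c d : ℝ) (h : a * d ≠ b * c) :
    ∫ u in (0:ℝ)..1, 1 / Real.sqrt ((a + b*u)^2 + (c + d*u)^2)
      = (1 / Real.sqrt (b^2 + d^2)) *
        (Real.log ((a*b + c*d)/(b^2 + d^2) + 1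
            + Real.sqrt (((a+b)^2 + (c+d)^2)/(b^2 + d^2)))
         - Real.log ((a*b + c*d)/(b^2 + d^2)
            + Real.sqrt ((a^2 + c^2)/(b^2 + d^2)))) := by
  have hB : 0 < b ^ 2 + d ^ 2 := by
    by_contra hn
    have hb : b = 0 := by nlinarith [sq_nonneg b, sq_nonneg d]
    have hd : d = 0 := by nlinarith [sq_nonneg b, sq_nonneg d]
    simp [hb, hd] at h
  have hk : 0 < ((a * d - b * c) / (b ^ 2 + d ^ 2)) ^ 2 := by
    have := sub_ne_zero.2 h
    positivity
  have hquad (u : ℝ) : ((a + b * u) ^ 2 + (c + d * u) ^ 2) / (b ^ 2 + d ^ 2)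
      = (u + (a * b + c * d) / (b ^ 2 + d ^ 2)) ^ 2
        + ((a * d - b * c) / (b ^ 2 + d ^ 2)) ^ 2 := by
    field_simp
    ring
  have hint (u : ℝ) : 1 / √((a + b * u) ^ 2 + (c + d * u) ^ 2)
      = 1 / √(b ^ 2 + d ^ 2) * (1 / √((u + (a * b + c * d) / (b ^ 2 + d ^ 2)) ^ 2
        + ((a * d - b * c) / (b ^ 2 + d ^ 2)) ^ 2)) := by
    rw [← hquad, one_div_mul_one_div, ← Real.sqrt_mul hB.le, mul_div_cancel₀ _ hB.ne']
  have h0 := hquad 0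
  have h1 := hquad 1
  simp only [mul_zero, mul_one, add_zero] at h0 h1
  simp_rw [hint]
  rw [intervalIntegral.integral_const_mul,
    intervalIntegral.integral_comp_add_right
      (fun x => 1 / √(x ^ 2 + ((a * d - b * c) / (b ^ 2 + d ^ 2)) ^ 2)),
    integral_one_div_sqrt_sq_add hk, h0, h1, zero_add, add_comm 1]
end
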